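/- For every constant C ≥ 1 and every sufficiently large k, there exist integers 0 < x < y with y > x + k such that lcm{x, x+1, ..., x+k-1} > C · lcm{y, y+1, ..., y+k}. -/

import Mathlib

theorem fact_fac (k p : ℕ) : (k.factorial).factorization p = ∑ i ∈ Finset.range k, (i+1).factorization p := by
  rw [← Finset.prod_range_add_one_eq_factorial, Nat.factorization_prod_apply (fun _ _ => by omega)]

theorem fact_fac_le_one {k p : ℕ} (hp : p.Prime) (h : k < 2 * p) : (k.factorial).factorization p ≤ 1 := by
  induction k with
  | zero => simp
  | succ k ih =>
    rw [Nat.factorial_succ, Nat.factorization_mul (by omega) (Nat.factorial_ne_zero _), Finsupp.add_apply]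
    have ih := ih (by omega)
    by_cases hd : p ∣ k + 1
    · have hk : k + 1 = p := by
        obtain ⟨c, hc⟩ := hd
        have : c < 2 := by
          by_contra hcc
          have : 2 * p ≤ p * c := by nlinarith [hp.pos]
          omega
        interval_cases c <;> omega
      have h0 : (k.factorial).factorization p = 0 := by
        apply Nat.factorization_eq_zero_of_not_dvd
        rw [hp.dvd_factorial]; omega
      rw [h0, hk, hp.factorization_self]
    · rw [Nat.factorization_eq_zero_of_not_dvd hd]; omega

theorem fact_le_log {i k p : ℕ} (hi : i ≠ 0) (hik : i ≤ k) : i.factorization p ≤ p.log k := by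
  by_cases hp : p.Prime
  · exact Nat.le_log_of_pow_le hp.one_lt ((Nat.le_of_dvd (by omega) (Nat.ordProj_dvd i p)).trans hik)
  · rw [Nat.factorization_eq_zero_of_not_prime i hp]; omega

theorem Y_elem {k y Ly : ℕ} (hy0 : y ≠ 0) (hL : Ly ≠ 0)
    (hY : ∀ p : ℕ, p.Prime → p ^ (p.log k) ∣ y ∨ (k < 2 * p ∧ (p ∣ Ly ∨
      ∃ i₁ i₂, i₁ < i₂ ∧ i₂ ≤ k ∧ p ∣ y + i₁ ∧ p ∣ y + i₂))) (j : ℕ) (hj : j ≤ k) :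
    k.factorial * (y + j) ∣ (∏ i ∈ Finset.range (k+1), (y + i)) * Ly := by
  have hP : (∏ i ∈ Finset.range (k+1), (y + i)) ≠ 0 := Finset.prod_ne_zero_iff.mpr (fun _ _ => by omega)
  rw [← Nat.factorization_prime_le_iff_dvd (Nat.mul_ne_zero (Nat.factorial_ne_zero _) (by omega))
    (Nat.mul_ne_zero hP hL)]
  intro p hp
  rw [Nat.factorization_mul (Nat.factorial_ne_zero _) (by omega), Nat.factorization_mul hP hL,
    Finsupp.add_apply, Finsupp.add_apply, Nat.factorization_prod_apply (fun _ _ => by omega)]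
  rcases hY p hp with h | ⟨hk, h⟩
  · rw [fact_fac, Finset.sum_range_succ']
    have hya : p.log k ≤ y.factorization p := (hp.pow_dvd_iff_le_factorization hy0).mp h
    have hle : ∀ i ∈ Finset.range k, (i+1).factorization p ≤ (y + (i+1)).factorization p := by
      intro i hi
      rw [Finset.mem_range] at hi
      rw [← hp.pow_dvd_iff_le_factorization (by omega)]
      apply Nat.dvd_add
      · exact (pow_dvd_pow p (fact_le_log (by omega) (by omega))).trans h
      · exact Nat.ordProj_dvd _ _
    rcases Nat.eq_zero_or_pos j with rfl | hj0
    · have := Finset.sum_le_sum hle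
      simp only [add_zero] at *
      omega
    · obtain ⟨j, rfl⟩ : ∃ j', j = j' + 1 := ⟨j - 1, by omega⟩
      have hm : j ∈ Finset.range k := Finset.mem_range.mpr (by omega)
      rw [← Finset.add_sum_erase _ _ hm, ← Finset.add_sum_erase _ (fun i => (y + (i+1)).factorization p) hm]
      have := Finset.sum_le_sum (fun i (hi : i ∈ (Finset.range k).erase j) => hle i (Finset.mem_of_mem_erase hi))
      have h2 : (j+1).factorization p ≤ p.log k := fact_le_log (by omega) hj
      simp only [add_zero] at *
      omega
  · have h1 := fact_fac_le_one hp hk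
    have hm : j ∈ Finset.range (k+1) := Finset.mem_range.mpr (by omega)
    rw [← Finset.add_sum_erase _ _ hm]
    rcases h with h | ⟨i₁, i₂, h12, h2, hd1, hd2⟩
    · have := (hp.dvd_iff_one_le_factorization hL).mp h
      omega
    · obtain ⟨i, hi, hij, hd⟩ : ∃ i, i ≤ k ∧ i ≠ j ∧ p ∣ y + i := by
        by_cases h : i₁ = j
        · exact ⟨i₂, h2, by omega, hd2⟩
        · exact ⟨i₁, by omega, h, hd1⟩
      have hs := Finset.single_le_sum (f := fun i => (y+i).factorization p) (fun i _ => Nat.zero_le _)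
        (Finset.mem_erase.mpr ⟨hij, Finset.mem_range.mpr (by omega : i < k+1)⟩)
      have := (hp.dvd_iff_one_le_factorization (by omega)).mp hd
      omega

theorem Y_lcm {k y Ly : ℕ} (hy0 : y ≠ 0) (hL : Ly ≠ 0)
    (hY : ∀ p : ℕ, p.Prime → p ^ (p.log k) ∣ y ∨ (k < 2 * p ∧ (p ∣ Ly ∨
      ∃ i₁ i₂, i₁ < i₂ ∧ i₂ ≤ k ∧ p ∣ y + i₁ ∧ p ∣ y + i₂))) :
    k.factorial * (Finset.Icc y (y + k)).lcm id ≤ (∏ i ∈ Finset.range (k+1), (y + i)) * Ly := by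
  have hP : (∏ i ∈ Finset.range (k+1), (y + i)) ≠ 0 := Finset.prod_ne_zero_iff.mpr (fun _ _ => by omega)
  have key := Y_elem hy0 hL hY
  obtain ⟨D, hD⟩ := (Dvd.intro _ rfl).trans (key 0 (by omega))
  rw [hD]
  rw [hD] at key
  have hD0 : D ≠ 0 := by
    rintro rfl
    exact (Nat.mul_ne_zero hP hL) (by simpa using hD)
  refine Nat.mul_le_mul_left _ (Nat.le_of_dvd (by omega) (Finset.lcm_dvd ?_))
  intro b hb
  rw [Finset.mem_Icc] at hb
  have := key (b - y) (by omega)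
  rw [show y + (b - y) = b by omega] at this
  exact Nat.dvd_of_mul_dvd_mul_left (Nat.factorial_pos k) this

theorem X_lcm {k x Lx : ℕ} (hk0 : 1 ≤ k) (hx0 : x ≠ 0) (hL : Lx ≠ 0)
    (hX : ∀ p : ℕ, p.Prime → p ^ (p.log k) ∣ x - 1 ∨ (p ≤ k ∧ k < 2 * p ∧ (p ∣ Lx ∨
      ∀ i₁ i₂, i₁ < i₂ → i₂ < k → p ∣ x + i₁ → p ∣ x + i₂ → False))) :
    (∏ i ∈ Finset.range k, (x + i)) * Nat.lcmUpto k ≤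
      k.factorial * Lx * (Finset.Icc x (x + k - 1)).lcm id := by
  have hP : (∏ i ∈ Finset.range k, (x + i)) ≠ 0 := Finset.prod_ne_zero_iff.mpr (fun _ _ => by omega)
  have hlcm : (Finset.Icc x (x + k - 1)).lcm id ≠ 0 := by
    rw [Ne, Finset.lcm_eq_zero_iff]
    simp
    omega
  have hkL : k.factorial * Lx ≠ 0 := Nat.mul_ne_zero (Nat.factorial_ne_zero _) hL
  apply Nat.le_of_dvd (Nat.pos_of_ne_zero (Nat.mul_ne_zero hkL hlcm))
  rw [← Nat.factorization_prime_le_iff_dvd (Nat.mul_ne_zero hP (Nat.lcmUpto_ne_zero _))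
    (Nat.mul_ne_zero hkL hlcm)]
  intro p hp
  rw [Nat.factorization_mul hP (Nat.lcmUpto_ne_zero _), Nat.factorization_mul hkL hlcm,
    Nat.factorization_mul (Nat.factorial_ne_zero _) hL, Finsupp.add_apply, Finsupp.add_apply, Finsupp.add_apply,
    Nat.factorization_prod_apply (fun _ _ => by omega), Nat.factorization_lcmUpto k hp]
  obtain ⟨j, hj, hmax⟩ := Finset.exists_max_image (Finset.range k) (fun i => (x+i).factorization p)
    ⟨0, Finset.mem_range.mpr (by omega)⟩
  have hjk := Finset.mem_range.mp hj
  have hjl : (x+j).factorization p ≤ ((Finset.Icc x (x + k - 1)).lcm id).factorization p := by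
    apply (Nat.factorization_le_iff_dvd (by omega) hlcm).mpr
    exact Finset.dvd_lcm (f := id) (Finset.mem_Icc.mpr ⟨by omega, by omega⟩)
  have hdiff : ∀ i ∈ Finset.range k, i ≠ j → (x+i).factorization p ≤ p.log k := by
    intro i hi hij
    have hik := Finset.mem_range.mp hi
    have h1 := hmax i hi
    have d1 : p ^ (x+i).factorization p ∣ x + i := Nat.ordProj_dvd _ _
    have d2 : p ^ (x+i).factorization p ∣ x + j := (pow_dvd_pow p h1).trans (Nat.ordProj_dvd _ _)
    apply Nat.le_log_of_pow_le hp.one_lt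
    rcases lt_or_gt_of_ne hij with h | h
    · have := Nat.dvd_sub d2 d1
      exact (Nat.le_of_dvd (by omega) this).trans (by omega)
    · have := Nat.dvd_sub d1 d2
      exact (Nat.le_of_dvd (by omega) this).trans (by omega)
  rw [← Finset.add_sum_erase _ _ hj]
  rcases hX p hp with h | ⟨hpk, hk, h⟩
  · have hcong : ∀ i v, v ≤ p.log k → p ^ v ∣ x + i → p ^ v ∣ i + 1 := by
      intro i v hv hd
      have h' := (pow_dvd_pow p hv).trans h
      have := Nat.dvd_sub hd h'
      rwa [show x + i - (x - 1) = i + 1 by omega] at this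
    have hpa : p ^ p.log k ≤ k := Nat.pow_log_le_self p (by omega)
    have hpa0 : 0 < p ^ p.log k := pow_pos hp.pos _
    have hja : p.log k ≤ (j+1).factorization p := by
      rw [← hp.pow_dvd_iff_le_factorization (by omega)]
      apply hcong j _ le_rfl
      rw [hp.pow_dvd_iff_le_factorization (by omega)]
      refine le_trans ?_ (hmax (p ^ p.log k - 1) (Finset.mem_range.mpr (by omega)))
      rw [← hp.pow_dvd_iff_le_factorization (by omega)]
      rw [show x + (p ^ p.log k - 1) = (x - 1) + p ^ p.log k by omega]
      exact Nat.dvd_add h dvd_rfl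
    rw [fact_fac, ← Finset.add_sum_erase _ (fun i => (i+1).factorization p) hj]
    have : ∑ i ∈ (Finset.range k).erase j, (x+i).factorization p ≤
        ∑ i ∈ (Finset.range k).erase j, (i+1).factorization p := by
      apply Finset.sum_le_sum
      intro i hi
      rw [Finset.mem_erase] at hi
      rw [← hp.pow_dvd_iff_le_factorization (by omega)]
      exact hcong i _ (hdiff i hi.2 hi.1) (Nat.ordProj_dvd _ _)
    omega
  · have hp2 : 2 ≤ p := hp.two_le
    have hlog : p.log k = 1 := by
      rw [Nat.log_eq_one_iff]
      exact ⟨by nlinarith, by omega, hpk⟩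
    have h1 : 1 ≤ k.factorial.factorization p := by
      rw [← hp.dvd_iff_one_le_factorization (Nat.factorial_ne_zero _)]
      exact (hp.dvd_factorial).mpr hpk
    rw [hlog] at hdiff ⊢
    have hpos : ∀ i ∈ (Finset.range k).erase j, (x+i).factorization p ≠ 0 → p ∣ x + i ∧ p ∣ x + j := by
      intro i hi h0
      rw [Finset.mem_erase] at hi
      constructor
      · exact (hp.dvd_iff_one_le_factorization (by omega)).mpr (by omega)
      · exact (hp.dvd_iff_one_le_factorization (by omega)).mpr (by have := hmax i hi.2; omega)
    rcases h with h | h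
    · have hL1 := (hp.dvd_iff_one_le_factorization hL).mp h
      have hs : ∑ i ∈ (Finset.range k).erase j, (x+i).factorization p ≤ 1 := by
        by_cases hz : ∃ i ∈ (Finset.range k).erase j, (x+i).factorization p ≠ 0
        · obtain ⟨i, hi, h0⟩ := hz
          rw [← Finset.add_sum_erase _ _ hi]
          have hi' := Finset.mem_erase.mp hi
          have hir := Finset.mem_range.mp hi'.2
          have hi1 := hdiff i hi'.2 hi'.1
          have : ∑ i' ∈ ((Finset.range k).erase j).erase i, (x+i').factorization p = 0 := by
            apply Finset.sum_eq_zero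
            intro l hl
            rw [Finset.mem_erase] at hl
            by_contra hl0
            obtain ⟨a1, a2⟩ := hpos i hi h0
            obtain ⟨b1, _⟩ := hpos l hl.2 hl0
            have hl' := Finset.mem_erase.mp hl.2
            have hlr := Finset.mem_range.mp hl'.2
            have far : ∀ a b, a < b → p ∣ x + a → p ∣ x + b → a + p ≤ b := by
              intro a b hab ha hb
              have := Nat.le_of_dvd (by omega) (Nat.dvd_sub hb ha)
              omega
            rcases lt_or_gt_of_ne hl.1 with c1 | c1 <;> rcases lt_or_gt_of_ne hl'.1 with c2 | c2 <;>
            rcases lt_or_gt_of_ne hi'.1 with c3 | c3 <;>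
            first
              | omega
              | (have t1 := far _ _ c1 (by assumption) (by assumption)
                 have t2 := far _ _ c2 (by assumption) (by assumption)
                 have t3 := far _ _ c3 (by assumption) (by assumption)
                 omega)
          omega
        · push Not at hz
          rw [Finset.sum_eq_zero hz]; omega
      omega
    · have hs : ∑ i ∈ (Finset.range k).erase j, (x+i).factorization p = 0 := by
        apply Finset.sum_eq_zero
        intro i hi
        by_contra h0
        obtain ⟨a1, a2⟩ := hpos i hi h0
        have hi' := Finset.mem_erase.mp hi
        have hir := Finset.mem_range.mp hi'.2
        rcases lt_or_gt_of_ne hi'.1 with c | c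
        · exact h _ _ c hjk a1 a2
        · exact h _ _ c hir a2 a1
      omega

theorem card_res {q A c S W : ℕ} (hq : q.Prime) (hA : ¬ q ∣ A) :
    ((Finset.Ico S (S + W)).filter (fun s => q ∣ c + A * s)).card ≤ W / q + 1 := by
  rw [← Finset.card_range (W / q + 1)]
  apply Finset.card_le_card_of_injOn (fun s => (s - S) / q)
  · intro s hs
    simp only [Finset.coe_filter, Finset.mem_Ico, Set.mem_ofPred_eq] at hs
    simp only [Finset.coe_range, Set.mem_Iio]
    exact Nat.lt_succ_of_le (Nat.div_le_div_right (by omega))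
  · have main : ∀ s t, S ≤ s → s ≤ t → q ∣ c + A * s → q ∣ c + A * t → (s - S) / q = (t - S) / q → s = t := by
      intro s t hs hst h1 h2 he
      have h3 := Nat.dvd_sub h2 h1
      rw [show c + A * t - (c + A * s) = A * (t - s) by rw [Nat.mul_sub]; omega] at h3
      have h4 := (hq.dvd_mul.mp h3).resolve_left hA
      have e1 := Nat.div_add_mod (s - S) q
      have e2 := Nat.div_add_mod (t - S) q
      have l1 := Nat.mod_lt (s - S) hq.pos
      have l2 := Nat.mod_lt (t - S) hq.pos
      rw [he] at e1
      by_contra hne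
      have := Nat.le_of_dvd (by omega) h4
      omega
    intro s hs t ht he
    simp only [Finset.coe_filter, Finset.mem_Ico, Set.mem_ofPred_eq] at hs ht
    rcases le_total s t with h | h
    · exact main s t hs.1.1 h hs.2 ht.2 he
    · exact (main t s ht.1.1 h ht.2 hs.2 he.symm).symm

theorem card_bad {q A c S W : ℕ} (hq : q.Prime) (hA : ¬ q ∣ A) (F : Finset ℕ) (bad : ℕ → Prop) [DecidablePred bad]
    (hb : ∀ s, bad s → ∃ f ∈ F, q ∣ (c + f) + A * s) :
    ((Finset.Ico S (S + W)).filter bad).card ≤ F.card * (W / q + 1) := by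
  have : (Finset.Ico S (S + W)).filter bad ⊆
      F.biUnion (fun f => (Finset.Ico S (S + W)).filter (fun s => q ∣ (c + f) + A * s)) := by
    intro s hs
    rw [Finset.mem_filter] at hs
    obtain ⟨f, hf, h⟩ := hb s hs.2
    exact Finset.mem_biUnion.mpr ⟨f, hf, Finset.mem_filter.mpr ⟨hs.1, h⟩⟩
  refine (Finset.card_le_card this).trans (Finset.card_biUnion_le.trans ?_)
  rw [← smul_eq_mul]
  exact Finset.sum_le_card_nsmul _ _ _ (fun f _ => card_res hq hA)

open Classical in
theorem avg (R : Finset ℕ) (w : ℕ → ℝ) (hw : ∀ q ∈ R, 0 ≤ w q) (S W : ℕ) (hW : 0 < W)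
    (bad : ℕ → ℕ → Prop) (β : ℕ → ℝ)
    (h : ∀ q ∈ R, (((Finset.Ico S (S + W)).filter (bad q)).card : ℝ) ≤ β q * W) :
    ∃ s ∈ Finset.Ico S (S + W), ∑ q ∈ R.filter (fun q => bad q s), w q ≤ ∑ q ∈ R, w q * β q := by
  apply Finset.exists_le_of_sum_le (Finset.nonempty_Ico.mpr (by omega))
  simp_rw [Finset.sum_filter]
  rw [Finset.sum_comm, Finset.sum_const, Nat.card_Ico, nsmul_eq_mul, Finset.mul_sum]
  apply Finset.sum_le_sum
  intro q hq
  rw [← Finset.sum_filter, Finset.sum_const, nsmul_eq_mul]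
  have := mul_le_mul_of_nonneg_right (h q hq) (hw q hq)
  rw [show S + W - S = W by omega]
  linarith

theorem central_le (n : ℕ) (n_large : 2 < n) :
    n.centralBinom ≤ (2 * n) ^ Nat.sqrt (2 * n) * 4 ^ (2 * n / 3) *
      (2 * n) ^ ((Finset.Ioc n (2 * n)).filter Nat.Prime).card := by
  have n_pos : 0 < n := (Nat.zero_le _).trans_lt n_large
  have n2_pos : 1 ≤ 2 * n := by omega
  let S := {p ∈ Finset.range (2 * n / 3 + 1) | Nat.Prime p}
  let T := (Finset.Ioc n (2 * n)).filter Nat.Prime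
  let f x := x ^ n.centralBinom.factorization x
  have hdisj : Disjoint S T := by
    rw [Finset.disjoint_left]
    intro p hp hp'
    simp only [S, T, Finset.mem_filter, Finset.mem_range, Finset.mem_Ioc] at hp hp'
    omega
  have : n.centralBinom = ∏ x ∈ S ∪ T, f x := by
    refine (Eq.trans ?_ n.prod_pow_factorization_centralBinom).symm
    apply Finset.prod_subset
    · intro p hp
      simp only [S, T, Finset.mem_union, Finset.mem_filter, Finset.mem_range, Finset.mem_Ioc] at hp ⊢
      omega
    · intro x hx h2x
      simp only [S, T, Finset.mem_union, Finset.mem_filter, Finset.mem_range, Finset.mem_Ioc] at hx h2x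
      by_cases hp : x.Prime
      · simp only [hp, and_true, not_or] at h2x
        simp only [f]
        rw [Nat.factorization_centralBinom_of_two_mul_self_lt_three_mul n_large (by omega) (by omega), pow_zero]
      · simp only [f]
        rw [Nat.factorization_eq_zero_of_not_prime n.centralBinom hp, pow_zero]
  have hf2 : ∀ p, f p ≤ 2 * n := fun p => Nat.pow_factorization_choose_le (by omega)
  rw [this, Finset.prod_union hdisj, ← Finset.prod_filter_mul_prod_filter_not S (· ≤ Nat.sqrt (2 * n))]
  apply mul_le_mul'
  · apply mul_le_mul'
    · refine (Finset.prod_le_prod' fun p _ => hf2 p).trans ?_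
      have : (Finset.Icc 1 (Nat.sqrt (2 * n))).card = Nat.sqrt (2 * n) := by rw [Nat.card_Icc, Nat.add_sub_cancel]
      rw [Finset.prod_const]
      refine pow_right_mono₀ n2_pos ((Finset.card_le_card fun x hx => ?_).trans this.le)
      obtain ⟨h1, h2⟩ := Finset.mem_filter.1 hx
      exact Finset.mem_Icc.mpr ⟨(Finset.mem_filter.1 h1).2.one_lt.le, h2⟩
    · refine le_trans ?_ (primorial_le_four_pow (2 * n / 3))
      refine (Finset.prod_le_prod' fun p hp => (?_ : f p ≤ p)).trans ?_
      · obtain ⟨h1, h2⟩ := Finset.mem_filter.1 hp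
        refine (pow_right_mono₀ (Finset.mem_filter.1 h1).2.one_lt.le ?_).trans (pow_one p).le
        exact Nat.factorization_choose_le_one (Nat.sqrt_lt'.mp <| not_le.1 h2)
      refine Finset.prod_le_prod_of_subset_of_one_le' (Finset.filter_subset _ _) ?_
      exact fun p hp _ => (Finset.mem_filter.1 hp).2.one_lt.le
  · refine (Finset.prod_le_prod' fun p _ => hf2 p).trans ?_
    rw [Finset.prod_const]

theorem card_log (n : ℕ) (hn : 4 ≤ n) :
    (n : ℝ) / 3 ≤ (√(2 * n) + 1 + ((Finset.Ioc n (2 * n)).filter Nat.Prime).card) * Real.log (2 * n) := by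
  have h1 := Nat.four_pow_lt_mul_centralBinom n hn
  have h2 := central_le n (by omega)
  set N := ((Finset.Ioc n (2 * n)).filter Nat.Prime).card
  have h3 : 4 ^ n ≤ n * ((2 * n) ^ Nat.sqrt (2 * n) * 4 ^ (2 * n / 3) * (2 * n) ^ N) :=
    h1.le.trans (Nat.mul_le_mul_left _ h2)
  have hn0 : (0:ℝ) < n := by exact_mod_cast (by omega : 0 < n)
  have h4 : (4:ℝ) ^ n ≤ n * ((2 * n) ^ Nat.sqrt (2 * n) * 4 ^ (2 * n / 3) * (2 * n) ^ N) := by exact_mod_cast h3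
  have h5 := Real.log_le_log (by positivity) h4
  rw [Real.log_mul (by positivity) (by positivity), Real.log_mul (by positivity) (by positivity),
    Real.log_mul (by positivity) (by positivity), Real.log_pow, Real.log_pow, Real.log_pow, Real.log_pow] at h5
  have h6 : Real.log n ≤ Real.log (2 * n) := Real.log_le_log hn0 (by linarith)
  have h7 : (Nat.sqrt (2 * n) : ℝ) ≤ √(2 * n) := by exact_mod_cast Real.nat_sqrt_le_real_sqrt (a := 2 * n)
  have h8 : ((2 * n / 3 : ℕ) : ℝ) ≤ 2 * n / 3 := by
    have := Nat.cast_div_le (α := ℝ) (m := 2 * n) (n := 3)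
    push_cast at this; exact this
  have h9 : 1 ≤ Real.log 4 := by
    rw [Real.le_log_iff_exp_le (by norm_num)]
    linarith [Real.exp_one_lt_d9]
  have h10 : 0 ≤ Real.log (2 * n) := Real.log_nonneg (by have : (4:ℝ) ≤ n := by exact_mod_cast hn
                                                         linarith)
  nlinarith [mul_le_mul_of_nonneg_right h7 h10, mul_le_mul_of_nonneg_right h8 (by linarith : 0 ≤ Real.log 4)]

/-- For large `k`, many pairs of primes in `(k/2, k]`. -/
theorem prime_pairs (K : ℝ) : ∃ k₀ : ℕ, ∀ k : ℕ, k₀ ≤ k → ∃ n : ℕ, 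
    K + 5 * Real.log k < (n : ℝ) ^ 2 / k ∧ ∃ a b : ℕ → ℕ, Function.Injective a ∧ Function.Injective b ∧
      (∀ i < n, (a i).Prime ∧ (b i).Prime ∧ k < 2 * a i ∧ a i + n ≤ b i ∧ b i ≤ k) := by
  -- asymptotics
  have hlim1 : ∀ᶠ k : ℕ in Filter.atTop, Real.log k ≤ (1/1000) * (k : ℝ) ^ (1/8 : ℝ) :=
    ((isLittleO_log_rpow_atTop (by norm_num : (0:ℝ) < 1/8)).bound (by norm_num : (0:ℝ) < 1/1000)).natCast_atTop.mono (by
      intro k hk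
      rw [Real.norm_eq_abs, Real.norm_of_nonneg (by positivity)] at hk
      exact (le_abs_self _).trans hk)
  have hlim2 : ∀ᶠ k : ℕ in Filter.atTop, |K| + 100 ≤ (k : ℝ) ^ (1/8 : ℝ) :=
    ((tendsto_rpow_atTop (by norm_num : (0:ℝ) < 1/8)).comp tendsto_natCast_atTop_atTop).eventually_ge_atTop _
  obtain ⟨k₀, hk₀⟩ := Filter.eventually_atTop.mp (hlim1.and hlim2)
  refine ⟨max k₀ 100, fun k hk => ?_⟩
  obtain ⟨g1, g2⟩ := hk₀ k (le_trans (le_max_left _ _) hk)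
  have hk100 : 100 ≤ k := le_trans (le_max_right _ _) hk
  set m := k / 2 with hm
  set N := ((Finset.Ioc m (2 * m)).filter Nat.Prime).card with hN
  have hcl := card_log m (by omega)
  have hcount : Nat.count Nat.Prime (2 * m + 1) = Nat.count Nat.Prime (m + 1) + N := by
    rw [Nat.count_eq_card_filter_range, Nat.count_eq_card_filter_range, hN, ← Finset.card_union_of_disjoint]
    · congr 1
      ext p
      simp only [Finset.mem_filter, Finset.mem_range, Finset.mem_union, Finset.mem_Ioc]
      constructor
      · rintro ⟨h, hp⟩
        by_cases h' : p < m + 1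
        · exact Or.inl ⟨h', hp⟩
        · exact Or.inr ⟨by omega, hp⟩
      · rintro (h | h)
        · exact ⟨by omega, h.2⟩
        · exact ⟨by omega, h.2⟩
    · rw [Finset.disjoint_left]
      intro p h1 h2
      simp only [Finset.mem_filter, Finset.mem_range, Finset.mem_Ioc] at h1 h2
      omega
  set c := Nat.count Nat.Prime (m + 1) with hc
  have hmono : StrictMono (Nat.nth Nat.Prime) := Nat.nth_strictMono Nat.infinite_setOfPred_prime
  refine ⟨N / 2, ?_, fun i => Nat.nth Nat.Prime (c + i), fun i => Nat.nth Nat.Prime (c + N / 2 + i), ?_, ?_, ?_⟩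
  · set u : ℝ := (k : ℝ) ^ (1/8 : ℝ) with hu
    have hu8 : u ^ 8 = k := by
      rw [hu, ← Real.rpow_natCast, ← Real.rpow_mul (by positivity)]; norm_num
    have hu100 : 100 ≤ u := by linarith [abs_nonneg K]
    have hmk : (2:ℝ) * m ≤ k := by exact_mod_cast (by omega : 2 * m ≤ k)
    have hmk' : (k:ℝ) ≤ 2 * m + 1 := by exact_mod_cast (by omega : k ≤ 2 * m + 1)
    have hm0 : (0:ℝ) < m := by exact_mod_cast (by omega : 0 < m)
    have hlog : Real.log (2 * m) ≤ (1/1000) * u := (Real.log_le_log (by positivity) hmk).trans g1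
    have hs : √(2 * m) ≤ u ^ 4 := by
      rw [Real.sqrt_le_left (by positivity)]
      nlinarith
    have hb : (m:ℝ) / 3 ≤ (u ^ 4 + 1 + N) * ((1/1000) * u) := by
      refine hcl.trans ?_
      have : 0 ≤ Real.log (2 * m) := Real.log_nonneg (by
        have : (1:ℝ) ≤ m := by exact_mod_cast (by omega : 1 ≤ m)
        linarith)
      gcongr
    have hn2 : (N:ℝ) ≤ 2 * (N / 2 : ℕ) + 1 := by exact_mod_cast (by omega : N ≤ 2 * (N / 2) + 1)
    set n : ℝ := ((N / 2 : ℕ) : ℝ)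
    have hn6 : u ^ 6 ≤ n := by
      by_contra hlt
      push Not at hlt
      have h1 : (m:ℝ)/3 ≤ (u^4 + 2 + 2 * u^6) * ((1/1000) * u) := by
        refine hb.trans (mul_le_mul_of_nonneg_right ?_ (by linarith))
        linarith
      have p4 : 100 * u ^ 4 ≤ u ^ 5 := by nlinarith [pow_pos (by linarith : 0 < u) 4]
      have p5 : 100 * u ^ 5 ≤ u ^ 6 := by nlinarith [pow_pos (by linarith : 0 < u) 5]
      have p7 : 100 * u ^ 7 ≤ u ^ 8 := by nlinarith [pow_pos (by linarith : 0 < u) 7]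
      have p6 : 100 * u ^ 6 ≤ u ^ 7 := by nlinarith [pow_pos (by linarith : 0 < u) 6]
      have p1 : u ≤ u ^ 5 := by nlinarith [one_le_pow₀ (by linarith : 1 ≤ u) (n := 4)]
      have p0 : 1 ≤ u ^ 5 := one_le_pow₀ (by linarith)
      nlinarith
    have hk0 : (0:ℝ) < k := by exact_mod_cast (by omega : 0 < k)
    rw [lt_div_iff₀ hk0]
    have h2 : (u ^ 6) ^ 2 ≤ n ^ 2 := by gcongr
    refine lt_of_lt_of_le ?_ h2
    have hK := le_abs_self K
    have h3 : K + 5 * Real.log k < 2 * u := by linarith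
    calc (K + 5 * Real.log k) * k < 2 * u * k := by gcongr
      _ = 2 * u ^ 9 := by rw [← hu8]; ring
      _ ≤ u ^ 3 * u ^ 9 := by
        gcongr
        have : 1 ≤ u ^ 2 := one_le_pow₀ (by linarith)
        nlinarith
      _ = (u ^ 6) ^ 2 := by ring
  · intro i j h
    have := hmono.injective h
    omega
  · intro i j h
    have := hmono.injective h
    omega
  · intro i hi
    refine ⟨Nat.prime_nth_prime _, Nat.prime_nth_prime _, ?_, ?_, ?_⟩
    · have h1 : m + 1 ≤ Nat.nth Nat.Prime (c + i) := by
        refine (Nat.count_le_iff_le_nth Nat.infinite_setOfPred_prime).mp ?_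
        show c ≤ c + i
        omega
      show k < 2 * Nat.nth Nat.Prime (c + i)
      omega
    · have := hmono.add_le_nat (N / 2) (c + i)
      simp only
      rw [show c + N / 2 + i = N / 2 + (c + i) by omega]
      omega
    · have : Nat.nth Nat.Prime (c + N / 2 + i) < 2 * m + 1 := Nat.nth_lt_of_lt_count (by omega)
      simp only
      omega

/-- primes in `(k/2, k]` -/
def Good (k : ℕ) (R : Finset ℕ) : Prop := ∀ q ∈ R, q.Prime ∧ k < 2 * q ∧ q ≤ k

theorem modulus {k : ℕ} {R : Finset ℕ} (hR : Good k R) :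
    ∃ A : ℕ, A * (∏ q ∈ R, q) = Nat.lcmUpto k ∧ A ≠ 0 ∧ (∀ q ∈ R, ¬ q ∣ A) ∧
      ∀ p : ℕ, p.Prime → p ∉ R → p ^ (p.log k) ∣ A := by
  have hd : (∏ q ∈ R, q) ∣ Nat.lcmUpto k := by
    apply Finset.prod_primes_dvd
    · intro q hq; exact (hR q hq).1.prime
    · intro q hq
      have := hR q hq
      exact Finset.dvd_lcm (f := id) (Finset.mem_Icc.mpr ⟨this.1.one_lt.le, this.2.2⟩)
  obtain ⟨A, hA⟩ := hd
  have hA0 : A ≠ 0 := by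
    rintro rfl
    exact Nat.lcmUpto_ne_zero k (by simpa using hA)
  refine ⟨A, by rw [hA, mul_comm], hA0, ?_, ?_⟩
  · intro q hq hqA
    obtain ⟨hp, h1, h2⟩ := hR q hq
    have h3 : q ^ 2 ∣ Nat.lcmUpto k := by
      rw [hA, sq]
      exact mul_dvd_mul (Finset.dvd_prod_of_mem _ hq) hqA
    have h4 := (hp.pow_dvd_iff_le_factorization (Nat.lcmUpto_ne_zero k)).mp h3
    rw [Nat.factorization_lcmUpto k hp] at h4
    have h5 : q ^ 2 ≤ k := (Nat.pow_le_pow_right hp.pos h4).trans (Nat.pow_log_le_self q (by have := hp.pos; omega))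
    nlinarith [hp.two_le]
  · intro p hp hpR
    have h1 : p ^ (p.log k) ∣ Nat.lcmUpto k := by
      rw [hp.pow_dvd_iff_le_factorization (Nat.lcmUpto_ne_zero k), Nat.factorization_lcmUpto k hp]
    rw [hA] at h1
    refine Nat.Coprime.dvd_of_dvd_mul_left ?_ h1
    apply Nat.Coprime.pow_left
    apply Nat.Coprime.prod_right
    intro q hq
    rw [Nat.coprime_primes hp (hR q hq).1]
    rintro rfl
    exact hpR hq

theorem log_prod_sub {k : ℕ} {R : Finset ℕ} (hR : Good k R) :
    Real.log ((∏ q ∈ R, q : ℕ) : ℝ) = ∑ q ∈ R, Real.log q := by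
  rw [Nat.cast_prod, Real.log_prod]
  intro q hq
  exact_mod_cast (hR q hq).1.ne_zero

theorem card_to_beta {k q c W : ℕ} {u : ℝ} (hk : 0 < k) (hq : 0 < q) (hW : W = k ^ 2) (hcu : (c : ℝ) ≤ u) (huk : u ≤ k) :
    ((c * (W / q + 1) : ℕ) : ℝ) ≤ (u / q + 1 / k) * W := by
  have hk' : (0:ℝ) < k := by exact_mod_cast hk
  have hq' : (0:ℝ) < q := by exact_mod_cast hq
  have h1 : ((W / q : ℕ) : ℝ) ≤ (W : ℝ) / q := Nat.cast_div_le
  have hu0 : 0 ≤ u := le_trans (by positivity) hcu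
  push_cast
  calc (c : ℝ) * (((W / q : ℕ) : ℝ) + 1) ≤ u * ((W : ℝ) / q + 1) := by gcongr
    _ = u / q * W + u := by ring
    _ ≤ u / q * W + k := by gcongr
    _ = (u / q + 1 / k) * W := by
      rw [hW]; push_cast; field_simp

open Classical in
theorem xsel {k : ℕ} (hk : 0 < k) {R : Finset ℕ} (hR : Good k R) {A : ℕ} (hA : ∀ q ∈ R, ¬ q ∣ A)
    (hA' : ∀ p : ℕ, p.Prime → p ∉ R → p ^ (p.log k) ∣ A) (S : ℕ) :
    ∃ s ∈ Finset.Ico S (S + k ^ 2), ∃ Lx : ℕ, Lx ≠ 0 ∧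
      Real.log Lx ≤ ∑ q ∈ R, Real.log q * (((k:ℝ) - q) / q + 1 / k) ∧
      ∀ p : ℕ, p.Prime → p ^ (p.log k) ∣ (1 + A * s) - 1 ∨ (p ≤ k ∧ k < 2 * p ∧ (p ∣ Lx ∨
      ∀ i₁ i₂, i₁ < i₂ → i₂ < k → p ∣ (1 + A * s) + i₁ → p ∣ (1 + A * s) + i₂ → False)) := by
  let bad : ℕ → ℕ → Prop := fun q s =>
    ∃ i₁ i₂, i₁ < i₂ ∧ i₂ < k ∧ q ∣ (1 + A * s) + i₁ ∧ q ∣ (1 + A * s) + i₂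
  obtain ⟨s, hs, hsum⟩ := avg R (fun q => Real.log q)
    (fun q hq => Real.log_nonneg (by exact_mod_cast (hR q hq).1.one_lt.le)) S (k ^ 2) (by positivity)
    bad (fun q => ((k:ℝ) - q) / q + 1 / k) (by
      intro q hq
      obtain ⟨hp, h1, h2⟩ := hR q hq
      have hc := card_bad (S := S) (W := k ^ 2) (c := 1) hp (hA q hq) (Finset.range (k - q)) (bad q) (by
        rintro s ⟨i₁, i₂, h12, hi2, d1, d2⟩
        refine ⟨i₁, Finset.mem_range.mpr ?_, ?_⟩
        · have := Nat.le_of_dvd (by omega) (Nat.dvd_sub d2 d1)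
          omega
        · rwa [show 1 + i₁ + A * s = 1 + A * s + i₁ by ring])
      rw [Finset.card_range] at hc
      refine le_trans (Nat.cast_le.mpr hc) ?_
      apply card_to_beta hk hp.pos rfl
      · rw [Nat.cast_sub h2]
      · have : (0:ℝ) ≤ q := by positivity
        linarith)
  have hG : Good k (R.filter (fun q => bad q s)) := fun q hq => hR q (Finset.mem_filter.mp hq).1
  refine ⟨s, hs, ∏ q ∈ R.filter (fun q => bad q s), q, ?_, ?_, ?_⟩
  · exact Finset.prod_ne_zero_iff.mpr (fun q hq => (hG q hq).1.ne_zero)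
  · rw [log_prod_sub hG]; exact hsum
  · intro p hp
    by_cases hpR : p ∈ R
    · right
      refine ⟨(hR p hpR).2.2, (hR p hpR).2.1, ?_⟩
      by_cases hb : bad p s
      · left; exact Finset.dvd_prod_of_mem _ (Finset.mem_filter.mpr ⟨hpR, hb⟩)
      · right
        intro i₁ i₂ h1 h2 h3 h4
        exact hb ⟨i₁, i₂, h1, h2, h3, h4⟩
    · left
      rw [Nat.add_sub_cancel_left]
      exact (hA' p hp hpR).mul_right s

open Classical in
theorem ysel {k : ℕ} (hk : 0 < k) {R : Finset ℕ} (hR : Good k R) {A : ℕ} (hA : ∀ q ∈ R, ¬ q ∣ A)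
    (hA' : ∀ p : ℕ, p.Prime → p ∉ R → p ^ (p.log k) ∣ A) (S : ℕ) :
    ∃ s ∈ Finset.Ico S (S + k ^ 2), ∃ Ly : ℕ, Ly ≠ 0 ∧
      Real.log Ly ≤ ∑ q ∈ R, Real.log q * ((2 * (q:ℝ) - k) / q + 1 / k) ∧
      ∀ p : ℕ, p.Prime → p ^ (p.log k) ∣ A * s ∨ (k < 2 * p ∧ (p ∣ Ly ∨
      ∃ i₁ i₂, i₁ < i₂ ∧ i₂ ≤ k ∧ p ∣ A * s + i₁ ∧ p ∣ A * s + i₂)) := by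
  obtain ⟨bad, hbad⟩ : ∃ bad : ℕ → ℕ → Prop, ∀ q s, bad q s ↔
      ¬ ∃ i₁ i₂, i₁ < i₂ ∧ i₂ ≤ k ∧ q ∣ A * s + i₁ ∧ q ∣ A * s + i₂ := ⟨fun q s => _, fun _ _ => Iff.rfl⟩
  obtain ⟨s, hs, hsum⟩ := avg R (fun q => Real.log q)
    (fun q hq => Real.log_nonneg (by exact_mod_cast (hR q hq).1.one_lt.le)) S (k ^ 2) (by positivity)
    bad (fun q => (2 * (q:ℝ) - k) / q + 1 / k) (by
      intro q hq
      obtain ⟨hp, h1, h2⟩ := hR q hq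
      have hc := card_bad (S := S) (W := k ^ 2) (c := 0) hp (hA q hq) (Finset.Ico (k - q + 1) q) (bad q) (by
        intro s hb
        obtain ⟨f, hf, hd⟩ : ∃ f < q, q ∣ A * s + f := by
          have e := Nat.div_add_mod (A * s) q
          have l := Nat.mod_lt (A * s) hp.pos
          rcases Nat.eq_zero_or_pos (A * s % q) with h0 | h0
          · exact ⟨0, hp.pos, by rw [add_zero]; exact Nat.dvd_of_mod_eq_zero h0⟩
          · refine ⟨q - A * s % q, by omega, ⟨A * s / q + 1, ?_⟩⟩
            rw [Nat.mul_add]; omega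
        refine ⟨f, Finset.mem_Ico.mpr ⟨?_, hf⟩, ?_⟩
        · by_contra hlt
          refine (hbad q s).mp hb ⟨f, f + q, by have := hp.pos; omega, by omega, hd, ?_⟩
          rw [← add_assoc]
          exact Nat.dvd_add hd dvd_rfl
        · rwa [show 0 + f + A * s = A * s + f by ring])
      rw [Nat.card_Ico] at hc
      refine le_trans (Nat.cast_le.mpr hc) ?_
      apply card_to_beta hk hp.pos rfl
      · have h3 : q - (k - q + 1) + k ≤ 2 * q := by omega
        have h4 : ((q - (k - q + 1) : ℕ) : ℝ) + k ≤ 2 * q := by exact_mod_cast h3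
        linarith
      · have : (q:ℝ) ≤ k := by exact_mod_cast h2
        linarith)
  have hG : Good k (R.filter (fun q => bad q s)) := fun q hq => hR q (Finset.mem_filter.mp hq).1
  refine ⟨s, hs, ∏ q ∈ R.filter (fun q => bad q s), q, ?_, ?_, ?_⟩
  · exact Finset.prod_ne_zero_iff.mpr (fun q hq => (hG q hq).1.ne_zero)
  · rw [log_prod_sub hG]; exact hsum
  · intro p hp
    by_cases hpR : p ∈ R
    · right
      refine ⟨(hR p hpR).2.1, ?_⟩
      by_cases hb : bad p s
      · left; exact Finset.dvd_prod_of_mem _ (Finset.mem_filter.mpr ⟨hpR, hb⟩)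
      · right
        rwa [hbad, not_not] at hb
    · left
      exact (hA' p hp hpR).mul_right s

theorem pair1 {a b k n : ℝ} (h3 : 3 ≤ a) (hn : 0 ≤ n) (hka : k < 2 * a) (hab : a + n ≤ b) (hbk : b ≤ k) :
    n / k ≤ Real.log b - Real.log b * ((k - b) / b) - Real.log a * ((2 * a - k) / a) := by
  have hl1 : 1 ≤ Real.log a := by
    rw [Real.le_log_iff_exp_le (by linarith)]
    linarith [Real.exp_one_lt_d9]
  have hab' : Real.log a ≤ Real.log b := Real.log_le_log (by linarith) (by linarith)
  have hb0 : 0 < b := by linarith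
  have ha0 : 0 < a := by linarith
  have hk0 : 0 < k := by linarith
  have e1 : Real.log b - Real.log b * ((k - b) / b) = Real.log b * ((2 * b - k) / b) := by
    field_simp; ring
  rw [e1]
  have h1 : Real.log a * ((2 * b - k) / b) ≤ Real.log b * ((2 * b - k) / b) :=
    mul_le_mul_of_nonneg_right hab' (div_nonneg (by linarith) hb0.le)
  have h2 : Real.log a * ((2 * b - k) / b) - Real.log a * ((2 * a - k) / a) = Real.log a * (k * (b - a) / (a * b)) := by
    field_simp; ring
  have h4 : n / k ≤ k * (b - a) / (a * b) := by
    rw [div_le_div_iff₀ hk0 (by positivity)]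
    have : a * b ≤ k * k := by nlinarith
    calc n * (a * b) ≤ (b - a) * (k * k) := by
          apply mul_le_mul (by linarith) this (by positivity) (by linarith)
      _ = _ := by ring
  have h5 : 0 ≤ n / k := by positivity
  nlinarith

theorem pair2 {a b k n : ℝ} (h3 : 3 ≤ a) (hn : 0 ≤ n) (hab : a + n ≤ b) (hbk : b ≤ k) :
    n / k ≤ Real.log a - Real.log b * ((k - b) / b) - Real.log a * ((2 * a - k) / a) := by
  have hb0 : 0 < b := by linarith
  have ha0 : 0 < a := by linarith
  have hk0 : 0 < k := by linarith
  have hanti : Real.log b / b ≤ Real.log a / a :=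
    Real.log_div_self_antitoneOn (by simp; linarith [Real.exp_one_lt_d9])
      (by simp; linarith [Real.exp_one_lt_d9]) (by linarith)
  have e : Real.log a - Real.log b * ((k - b) / b) - Real.log a * ((2 * a - k) / a) =
      k * (Real.log a / a - Real.log b / b) + (Real.log b - Real.log a) := by
    field_simp; ring
  have h1 : 1 - (b / a)⁻¹ ≤ Real.log (b / a) := Real.one_sub_inv_le_log_of_pos (by positivity)
  rw [Real.log_div hb0.ne' ha0.ne', inv_div] at h1
  have h2 : n / k ≤ 1 - a / b := by
    rw [show 1 - a / b = (b - a) / b by field_simp]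
    exact div_le_div₀ (by linarith) (by linarith) hb0 hbk
  have h4 : 0 ≤ k * (Real.log a / a - Real.log b / b) := mul_nonneg hk0.le (by linarith)
  linarith

theorem sum_bounds {k n : ℕ} {a b : ℕ → ℕ} (hk : 6 ≤ k) (hnk : n ≤ k)
    (h : ∀ i < n, (a i).Prime ∧ (b i).Prime ∧ k < 2 * a i ∧ a i + n ≤ b i ∧ b i ≤ k) :
    (n:ℝ) ^ 2 / k - 2 * Real.log k ≤ ∑ i ∈ Finset.range n, Real.log (b i)
      - ∑ i ∈ Finset.range n, Real.log (b i) * (((k:ℝ) - b i) / b i + 1 / k)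
      - ∑ i ∈ Finset.range n, Real.log (a i) * ((2 * (a i : ℝ) - k) / a i + 1 / k) ∧
    (n:ℝ) ^ 2 / k - 2 * Real.log k ≤ ∑ i ∈ Finset.range n, Real.log (a i)
      - ∑ i ∈ Finset.range n, Real.log (b i) * (((k:ℝ) - b i) / b i + 1 / k)
      - ∑ i ∈ Finset.range n, Real.log (a i) * ((2 * (a i : ℝ) - k) / a i + 1 / k) := by
  have hk0 : (0:ℝ) < k := by exact_mod_cast (by omega : 0 < k)
  have hlk : 0 ≤ Real.log k := Real.log_nonneg (by exact_mod_cast (by omega : 1 ≤ k))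
  have hconst : (n:ℝ) ^ 2 / k - 2 * Real.log k ≤ ∑ i ∈ Finset.range n, ((n:ℝ) / k - 2 * Real.log k / k) := by
    rw [Finset.sum_const, Finset.card_range, nsmul_eq_mul]
    have hnk' : (n:ℝ) / k ≤ 1 := by
      rw [div_le_one hk0]; exact_mod_cast hnk
    have : (n:ℝ) * ((n:ℝ) / k - 2 * Real.log k / k) = (n:ℝ)^2 / k - 2 * Real.log k * (n / k) := by ring
    rw [this]
    nlinarith
  have hlog : ∀ q : ℕ, 0 < q → q ≤ k → Real.log q * (1 / k) ≤ Real.log k / k := by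
    intro q hq hqk
    rw [mul_one_div]
    have : Real.log q ≤ Real.log k := Real.log_le_log (by exact_mod_cast hq) (by exact_mod_cast hqk)
    gcongr
  rw [← Finset.sum_sub_distrib, ← Finset.sum_sub_distrib, ← Finset.sum_sub_distrib, ← Finset.sum_sub_distrib]
  constructor
  all_goals
    refine hconst.trans (Finset.sum_le_sum ?_)
    intro i hi
    obtain ⟨ha, hb, h1, h2, h3⟩ := h i (Finset.mem_range.mp hi)
    have e1 := hlog (a i) ha.pos (by omega)
    have e2 := hlog (b i) hb.pos h3
    have f1 : (3:ℝ) ≤ a i := by exact_mod_cast (by omega : 3 ≤ a i)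
    have f2 : (k:ℝ) < 2 * a i := by exact_mod_cast h1
    have f3 : (a i : ℝ) + n ≤ b i := by exact_mod_cast h2
    have f4 : (b i : ℝ) ≤ k := by exact_mod_cast h3
    have p1 := pair1 f1 (Nat.cast_nonneg n) f2 f3 f4
    have p2 := pair2 f1 (Nat.cast_nonneg n) f3 f4
    have e3 : 2 * Real.log k / k = Real.log k / k + Real.log k / k := by ring
    rw [mul_add, mul_add, e3]
    linarith

theorem final_real {k H M Mx My Lx Ly PR PR' : ℕ} {C : ℝ} (hC : 1 ≤ C) (hk : 6 ≤ k)
    (hx : Mx * PR = M) (hy : My * PR' = M) (hMx : Mx ≠ 0) (hMy : My ≠ 0) (hM : M ≠ 0)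
    (hLx : Lx ≠ 0) (hLy : Ly ≠ 0)
    (hH : H = 4 * k ^ 2 * (Mx + My))
    (h1 : Real.log (40 * C * Real.exp 4) + 3 * Real.log k + Real.log Lx + Real.log Ly < Real.log PR)
    (h2 : Real.log (40 * C * Real.exp 4) + 3 * Real.log k + Real.log Lx + Real.log Ly < Real.log PR') :
    C * ((((k:ℝ) + 4) * H) ^ (k + 1) * Ly) * Lx < ((k:ℝ) * H) ^ k * M := by
  have hk0 : (0:ℝ) < k := by exact_mod_cast (by omega : 0 < k)
  have hk6 : (6:ℝ) ≤ k := by exact_mod_cast hk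
  have hC0 : 0 < C := by linarith
  have hLx0 : (0:ℝ) < Lx := by exact_mod_cast Nat.pos_of_ne_zero hLx
  have hLy0 : (0:ℝ) < Ly := by exact_mod_cast Nat.pos_of_ne_zero hLy
  have hMx0 : (0:ℝ) < Mx := by exact_mod_cast Nat.pos_of_ne_zero hMx
  have hMy0 : (0:ℝ) < My := by exact_mod_cast Nat.pos_of_ne_zero hMy
  have hH' : (H:ℝ) = 4 * k ^ 2 * (Mx + My) := by rw [hH]; push_cast; ring
  have hH0 : (0:ℝ) < H := by rw [hH']; positivity
  have key : ∀ P : ℕ, P ≠ 0 → Real.log (40 * C * Real.exp 4) + 3 * Real.log k + Real.log Lx + Real.log Ly < Real.log P →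
      40 * C * Real.exp 4 * k ^ 3 * Lx * Ly < P := by
    intro P hP h
    have hP0 : (0:ℝ) < P := by exact_mod_cast Nat.pos_of_ne_zero hP
    rw [← Real.log_lt_log_iff (by positivity) hP0, Real.log_mul (by positivity) (by positivity),
      Real.log_mul (by positivity) (by positivity), Real.log_mul (by positivity) (by positivity), Real.log_pow]
    exact_mod_cast h
  have hP : PR ≠ 0 := by rintro rfl; exact hM (by simpa using hx.symm)
  have hP' : PR' ≠ 0 := by rintro rfl; exact hM (by simpa using hy.symm)
  have k1 := mul_lt_mul_of_pos_left (key PR hP h1) hMx0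
  have k2 := mul_lt_mul_of_pos_left (key PR' hP' h2) hMy0
  have hx' : (Mx:ℝ) * PR = M := by exact_mod_cast hx
  have hy' : (My:ℝ) * PR' = M := by exact_mod_cast hy
  rw [hx'] at k1
  rw [hy'] at k2
  have hM' : C * Real.exp 4 * (5 * k) * H * Lx * Ly < M := by
    rw [hH']; nlinarith
  have hpow : ((k:ℝ) + 4) ^ k ≤ Real.exp 4 * (k:ℝ) ^ k := by
    have : (k:ℝ) + 4 ≤ Real.exp (4 / k) * k := by
      have := Real.add_one_le_exp (4 / (k:ℝ))
      calc (k:ℝ) + 4 = (4 / k + 1) * k := by field_simp; ring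
        _ ≤ _ := by gcongr
    calc ((k:ℝ) + 4) ^ k ≤ (Real.exp (4 / k) * k) ^ k := by gcongr
      _ = _ := by
        rw [mul_pow, ← Real.exp_nat_mul]
        congr 2
        field_simp
  calc C * ((((k:ℝ) + 4) * H) ^ (k + 1) * Ly) * Lx
      = C * ((k:ℝ) + 4) ^ k * (H ^ k) * (k + 4) * H * Ly * Lx := by rw [pow_succ, mul_pow]; ring
    _ ≤ C * (Real.exp 4 * (k:ℝ) ^ k) * (H ^ k) * (5 * k) * H * Ly * Lx := by
        gcongr
        linarith
    _ = ((k:ℝ) * H) ^ k * (C * Real.exp 4 * (5 * k) * H * Lx * Ly) := by rw [mul_pow]; ring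
    _ < _ := by gcongr

theorem main_theorem (C : ℝ) (hC : 1 ≤ C) :
    ∃ k₀ : ℕ, ∀ k : ℕ, k₀ ≤ k →
      ∃ x y : ℕ, 0 < x ∧ x < y ∧ x + k < y ∧
        (((Finset.Icc x (x + k - 1)).lcm id : ℕ) : ℝ) >
          C * (((Finset.Icc y (y + k)).lcm id : ℕ) : ℝ) := by
  obtain ⟨k₀, hk₀⟩ := prime_pairs (Real.log (40 * C * Real.exp 4))
  refine ⟨max k₀ 6, fun k hk => ?_⟩
  obtain ⟨n, hn, a, b, ha, hb, hab⟩ := hk₀ k (le_trans (le_max_left _ _) hk)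
  have hk6 : 6 ≤ k := le_trans (le_max_right _ _) hk
  have hnk : n ≤ k := by
    rcases Nat.eq_zero_or_pos n with h | h
    · omega
    · have := hab 0 h
      omega
  obtain ⟨sb1, sb2⟩ := sum_bounds hk6 hnk hab
  set R := (Finset.range n).image b with hRdef
  set R' := (Finset.range n).image a with hRdef'
  have hR : Good k R := by
    intro q hq
    obtain ⟨i, hi, rfl⟩ := Finset.mem_image.mp hq
    have := hab i (Finset.mem_range.mp hi)
    exact ⟨this.2.1, by omega, this.2.2.2.2⟩
  have hR' : Good k R' := by
    intro q hq
    obtain ⟨i, hi, rfl⟩ := Finset.mem_image.mp hq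
    have := hab i (Finset.mem_range.mp hi)
    exact ⟨this.1, by omega, by omega⟩
  obtain ⟨Mx, hMx, hMx0, hMx1, hMx2⟩ := modulus hR
  obtain ⟨My, hMy, hMy0, hMy1, hMy2⟩ := modulus hR'
  obtain ⟨H, hH⟩ : ∃ H, H = 4 * k ^ 2 * (Mx + My) := ⟨_, rfl⟩
  obtain ⟨s, hs, Lx, hLx0, hLx, hX⟩ := xsel (by omega) hR hMx1 hMx2 (k * H / Mx + 1)
  obtain ⟨t, ht, Ly, hLy0, hLy, hY⟩ := ysel (by omega) hR' hMy1 hMy2 ((k * H + H + k) / My + 1)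
  rw [Finset.mem_Ico] at hs ht
  have hMxp : 0 < Mx := Nat.pos_of_ne_zero hMx0
  have hMyp : 0 < My := Nat.pos_of_ne_zero hMy0
  -- sizes
  have hk2 : 36 ≤ k ^ 2 := by nlinarith
  have hkk : k ≤ k ^ 2 := by nlinarith
  have ax : k ^ 2 ≤ k ^ 2 * Mx := Nat.le_mul_of_pos_right _ hMxp
  have ay : k ^ 2 ≤ k ^ 2 * My := Nat.le_mul_of_pos_right _ hMyp
  have ax' : Mx ≤ k ^ 2 * Mx := Nat.le_mul_of_pos_left _ (by omega)
  have ay' : My ≤ k ^ 2 * My := Nat.le_mul_of_pos_left _ (by omega)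
  have hHe : H = 4 * (k ^ 2 * Mx) + 4 * (k ^ 2 * My) := by rw [hH]; ring
  have x1 : k * H < Mx * s :=
    lt_of_lt_of_le (Nat.lt_mul_div_succ _ hMxp) (Nat.mul_le_mul_left _ hs.1)
  have x2 : Mx * s ≤ k * H + Mx + k ^ 2 * Mx := by
    have h1 : Mx * s ≤ Mx * (k * H / Mx + 1 + k ^ 2) := Nat.mul_le_mul_left _ hs.2.le
    have h2 := Nat.mul_div_le (k * H) Mx
    have h3 : Mx * (k * H / Mx + 1 + k ^ 2) = Mx * (k * H / Mx) + Mx + k ^ 2 * Mx := by ring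
    omega
  have y1 : k * H + H + k < My * t :=
    lt_of_lt_of_le (Nat.lt_mul_div_succ _ hMyp) (Nat.mul_le_mul_left _ ht.1)
  have y2 : My * t ≤ k * H + H + k + My + k ^ 2 * My := by
    have h1 : My * t ≤ My * ((k * H + H + k) / My + 1 + k ^ 2) := Nat.mul_le_mul_left _ ht.2.le
    have h2 := Nat.mul_div_le (k * H + H + k) My
    have h3 : My * ((k * H + H + k) / My + 1 + k ^ 2) = My * ((k * H + H + k) / My) + My + k ^ 2 * My := by ring
    omega
  refine ⟨1 + Mx * s, My * t, by omega, by omega, by omega, ?_⟩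
  have bx := X_lcm (by omega) (by omega) hLx0 hX
  have bY := Y_lcm (by omega) hLy0 hY
  have px : (k * H) ^ k ≤ ∏ i ∈ Finset.range k, (1 + Mx * s + i) := by
    have := Finset.pow_card_le_prod (s := Finset.range k) (f := fun i => 1 + Mx * s + i) (n := k * H)
      (fun i _ => by omega)
    rwa [Finset.card_range] at this
  have py : ∏ i ∈ Finset.range (k + 1), (My * t + i) ≤ ((k + 4) * H) ^ (k + 1) := by
    have := Finset.prod_le_pow_card (Finset.range (k + 1)) (fun i => My * t + i) ((k + 4) * H)
      (fun i hi => by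
        have := Finset.mem_range.mp hi
        rw [Nat.add_mul]
        omega)
    rwa [Finset.card_range] at this
  set lx := (Finset.Icc (1 + Mx * s) (1 + Mx * s + k - 1)).lcm id
  set ly := (Finset.Icc (My * t) (My * t + k)).lcm id
  have c1 : (k * H) ^ k * Nat.lcmUpto k ≤ k.factorial * Lx * lx :=
    (Nat.mul_le_mul_right _ px).trans bx
  have c2 : k.factorial * ly ≤ ((k + 4) * H) ^ (k + 1) * Ly := bY.trans (Nat.mul_le_mul_right _ py)
  have c1' : ((k:ℝ) * H) ^ k * Nat.lcmUpto k ≤ k.factorial * Lx * lx := by exact_mod_cast c1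
  have c2' : (k.factorial : ℝ) * ly ≤ (((k:ℝ) + 4) * H) ^ (k + 1) * Ly := by exact_mod_cast c2
  have sR : ∀ f : ℕ → ℝ, ∑ q ∈ R, f q = ∑ i ∈ Finset.range n, f (b i) :=
    fun f => Finset.sum_image (fun i _ j _ h => hb h)
  have sR' : ∀ f : ℕ → ℝ, ∑ q ∈ R', f q = ∑ i ∈ Finset.range n, f (a i) :=
    fun f => Finset.sum_image (fun i _ j _ h => ha h)
  rw [sR] at hLx
  rw [sR'] at hLy
  have l1 := log_prod_sub hR
  have l2 := log_prod_sub hR'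
  rw [sR] at l1
  rw [sR'] at l2
  have fin := final_real hC hk6 hMx hMy hMx0 hMy0 (Nat.lcmUpto_ne_zero k) hLx0 hLy0 hH
    (by rw [l1]; linarith) (by rw [l2]; linarith)
  have hfac : (0:ℝ) < k.factorial := by exact_mod_cast Nat.factorial_pos k
  have hLxp : (0:ℝ) < Lx := by exact_mod_cast Nat.pos_of_ne_zero hLx0
  have hC0 : 0 < C := by linarith
  have e : (k.factorial * Lx : ℝ) * (C * ly) < (k.factorial * Lx : ℝ) * lx := by
    calc (k.factorial * Lx : ℝ) * (C * ly) = C * (k.factorial * ly) * Lx := by ring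
      _ ≤ C * ((((k:ℝ) + 4) * H) ^ (k + 1) * Ly) * Lx := by gcongr
      _ < _ := fin
      _ ≤ _ := c1'
  exact lt_of_mul_lt_mul_left e (by positivity)
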